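/- arXiv:1809.07427 — 2 statements merged into one kernel-verified Lean document; each statement's English description precedes it below -/
import Mathlib

section
/- Let X be an infinite set and let ξ be a cardinal with ξ = 1 or ℵ₀ ≤ ξ ≤ (#X)⁺. Then the relation μ_ξ = {(α,β) : #(cl(α) △ cl(β)) < ξ} is a congruence on the partition monoid P_X: there is c ∈ Con P_X with c α β ↔ #(cl(α) △ cl(β)) < ξ for all α, β. (Lemma 4.15.) -/
open Cardinal
open scoped symmDiff

namespace PartitionCongruences

variable {X : Type*}

/-- A partition over `X` is a setoid on `X ⊕ X`; `PMon X` is the carrier of the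
partition monoid. -/
abbrev PMon (X : Type*) := Setoid (X ⊕ X)

/-- The set of blocks of a partition. -/
def cl (α : PMon X) : Set (Set (X ⊕ X)) := α.classes

/-- A block of `α` is a transversal if it meets both summands. -/
def IsTransversal (α : PMon X) (B : Set (X ⊕ X)) : Prop :=
  B ∈ α.classes ∧ (∃ x : X, Sum.inl x ∈ B) ∧ (∃ x : X, Sum.inr x ∈ B)

/-- The rank of a partition: the number of its transversals. -/
def rank (α : PMon X) : Cardinal :=
  #{B : Set (X ⊕ X) // IsTransversal α B}

/-- The kernel partition `ᾱ`. -/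
def ker (α : PMon X) : Set (Set X) := (Setoid.comap Sum.inl α).classes

/-- The cokernel partition `α̲`. -/
def coker (α : PMon X) : Set (Set X) := (Setoid.comap Sum.inr α).classes

/-- Left summand to top copy, right summand to middle copy. -/
def dmap (X : Type*) : X ⊕ X → X ⊕ (X ⊕ X) :=
  Sum.elim Sum.inl (fun x => Sum.inr (Sum.inl x))

/-- Left summand to middle copy, right summand to bottom copy. -/
def umap (X : Type*) : X ⊕ X → X ⊕ (X ⊕ X) :=
  Sum.elim (fun x => Sum.inr (Sum.inl x)) (fun x => Sum.inr (Sum.inr x))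

/-- Left summand to top copy, right summand to bottom copy. -/
def emap (X : Type*) : X ⊕ X → X ⊕ (X ⊕ X) :=
  Sum.elim Sum.inl (fun x => Sum.inr (Sum.inr x))

/-- The pushforward of a setoid along a map: the smallest setoid relating `f x` and
`f y` whenever `σ` relates `x` and `y`. -/
def push {A B : Type*} (f : A → B) (σ : Setoid A) : Setoid B :=
  Relation.EqvGen.setoid (fun a b => ∃ x y, σ x y ∧ f x = a ∧ f y = b)

/-- The product of the partition monoid. -/
instance : Mul (PMon X) :=
  ⟨fun α β => Setoid.comap (emap X) (push (dmap X) α ⊔ push (umap X) β)⟩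


theorem push_le_iff {A B : Type*} {f : A → B} {σ : Setoid A} {τ : Setoid B} :
    push f σ ≤ τ ↔ ∀ a b, σ a b → τ (f a) (f b) := by
  constructor
  · intro h a b hab
    exact h (Relation.EqvGen.rel _ _ ⟨a, b, hab, rfl, rfl⟩)
  · intro h
    refine Setoid.eqvGen_le ?_
    rintro _ _ ⟨a, b, hab, rfl, rfl⟩
    exact h a b hab

/-- If `σ` and `σ'` agree on all points lying over the class of `w` in `push f σ ⊔ τ`, then `w`
has the same class in `push f σ' ⊔ τ`. -/
theorem push_sup_iff_of_agree {A B : Type*} {f : A → B} {σ σ' : Setoid A} {τ : Setoid B} {w : B}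
    (hw : ∀ a, (push f σ ⊔ τ) w (f a) → ∀ b, σ a b ↔ σ' a b) (z : B) :
    (push f σ ⊔ τ) w z ↔ (push f σ' ⊔ τ) w z := by
  set R := push f σ ⊔ τ with hR
  set R' := push f σ' ⊔ τ with hR'
  have hτR : τ ≤ R := le_sup_right
  have hτR' : τ ≤ R' := le_sup_right
  have hfR : ∀ a b, σ a b → R (f a) (f b) := push_le_iff.1 le_sup_left
  have hfR' : ∀ a b, σ' a b → R' (f a) (f b) := push_le_iff.1 le_sup_left
  constructor
  · let S : Setoid B :=
      { r := fun x y => R x y ∧ (R w x → R' x y)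
        iseqv :=
          { refl := fun x => ⟨R.refl x, fun _ => R'.refl x⟩
            symm := fun h => ⟨R.symm h.1, fun hx => R'.symm (h.2 (R.trans hx (R.symm h.1)))⟩
            trans := fun h k =>
              ⟨R.trans h.1 k.1, fun hx => R'.trans (h.2 hx) (k.2 (R.trans hx h.1))⟩ } }
    have hS : R ≤ S := sup_le
      (push_le_iff.2 fun a b hab => ⟨hfR a b hab, fun ha => hfR' a b ((hw a ha b).1 hab)⟩)
      (fun x y hxy => ⟨hτR hxy, fun _ => hτR' hxy⟩)
    exact fun h => (hS h).2 (R.refl w)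
  · have hS : R' ≤ Setoid.ker (fun x => R w x) := by
      have key : ∀ x y, (R w x → R x y) → (R w y → R y x) → R w x = R w y := fun x y h k =>
        propext ⟨fun hx => R.trans hx (h hx), fun hy => R.trans hy (k hy)⟩
      refine sup_le (push_le_iff.2 fun a b hab => key _ _ ?_ ?_) (fun x y hxy => key _ _ ?_ ?_)
      · exact fun ha => hfR a b ((hw a ha b).2 hab)
      · exact fun hb => hfR b a ((hw b hb a).2 (σ'.symm hab))
      · exact fun _ => hτR hxy
      · exact fun _ => hτR (τ.symm hxy)
    intro h
    have : R w w = R w z := hS h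
    exact this ▸ R.refl w

universe u v in
theorem mk_classes_comap_push_sup_diff_le {A V : Type u} {B : Type v} (f : A → B) (e : V → B)
    (σ σ' : Setoid A) (τ : Setoid B) :
    #↥((Setoid.comap e (push f σ ⊔ τ)).classes \ (Setoid.comap e (push f σ' ⊔ τ)).classes) ≤
      #↥(σ.classes \ σ'.classes) := by
  have key : ∀ C : ↥((Setoid.comap e (push f σ ⊔ τ)).classes \
      (Setoid.comap e (push f σ' ⊔ τ)).classes), ∃ D : ↥(σ.classes \ σ'.classes),
      ∃ a ∈ D.1, ∃ v, C.1 = {x | (push f σ ⊔ τ) (e x) (e v)} ∧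
        (push f σ ⊔ τ) (e v) (f a) := by
    rintro ⟨C, ⟨v, rfl⟩, hC⟩
    by_contra! hno
    refine hC ⟨v, ?_⟩
    ext x
    change (push f σ ⊔ τ) (e x) (e v) ↔ (push f σ' ⊔ τ) (e x) (e v)
    rw [Setoid.comm', Setoid.comm' (push f σ' ⊔ τ)]
    refine push_sup_iff_of_agree (fun a ha b => ?_) (e x)
    by_contra hab
    refine hno ⟨{y | σ y a}, Setoid.mem_classes σ a, ?_⟩ a (σ.refl a) v rfl ha
    rintro ⟨c, hc⟩
    have mem : ∀ y, σ y a ↔ σ' y c := fun y => Set.ext_iff.1 hc y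
    have hac := (mem a).1 (σ.refl a)
    refine hab ⟨fun h => ?_, fun h => ?_⟩
    · exact σ'.trans hac (σ'.symm ((mem b).1 (σ.symm h)))
    · exact σ.symm ((mem b).2 (σ'.trans (σ'.symm h) hac))
  choose D a ha v hv hva using key
  refine Cardinal.mk_le_of_injective (f := D) fun C C' h => ?_
  have haa : σ (a C) (a C') :=
    Setoid.rel_iff_exists_classes σ |>.2 ⟨D C, (D C).2.1, ha C, h ▸ ha C'⟩
  have hvv : (push f σ ⊔ τ) (e (v C)) (e (v C')) :=
    Setoid.trans' _ (Setoid.trans' _ (hva C) (push_le_iff.1 le_sup_left _ _ haa))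
      (Setoid.symm' _ (hva C'))
  refine Subtype.ext ?_
  rw [hv C, hv C']
  ext x
  exact ⟨fun hx => Setoid.trans' _ hx hvv, fun hx => Setoid.trans' _ hx (Setoid.symm' _ hvv)⟩

theorem mk_symmDiff_eq {A : Type*} (s t : Set A) : #↥(s ∆ t) = #↥(s \ t) + #↥(t \ s) :=
  Cardinal.mk_union_of_disjoint disjoint_sdiff_sdiff

theorem mk_cl_mul_right_symmDiff_le (α β γ : PMon X) :
    #↥(cl (α * γ) ∆ cl (β * γ)) ≤ #↥(cl α ∆ cl β) := by
  rw [mk_symmDiff_eq, mk_symmDiff_eq]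
  exact add_le_add
    (mk_classes_comap_push_sup_diff_le (dmap X) (emap X) α β (push (umap X) γ))
    (mk_classes_comap_push_sup_diff_le (dmap X) (emap X) β α (push (umap X) γ))

theorem mk_cl_mul_left_symmDiff_le (α β γ : PMon X) :
    #↥(cl (γ * α) ∆ cl (γ * β)) ≤ #↥(cl α ∆ cl β) := by
  have h : ∀ δ : PMon X,
      γ * δ = Setoid.comap (emap X) (push (umap X) δ ⊔ push (dmap X) γ) := fun δ =>
    congrArg (Setoid.comap (emap X)) (sup_comm _ _)
  rw [mk_symmDiff_eq, mk_symmDiff_eq, h, h]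
  exact add_le_add
    (mk_classes_comap_push_sup_diff_le (umap X) (emap X) α β (push (dmap X) γ))
    (mk_classes_comap_push_sup_diff_le (umap X) (emap X) β α (push (dmap X) γ))

theorem mk_symmDiff_lt_trans {A : Type*} {ξ : Cardinal} (hξ : ξ = 1 ∨ ℵ₀ ≤ ξ) {s t u : Set A}
    (hst : #↥(s ∆ t) < ξ) (htu : #↥(t ∆ u) < ξ) : #↥(s ∆ u) < ξ := by
  refine ((Cardinal.mk_le_mk_of_subset (symmDiff_triangle s t u)).trans
    (Cardinal.mk_union_le _ _)).trans_lt ?_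
  rcases hξ with rfl | hξ
  · rw [Cardinal.lt_one_iff] at *
    rw [hst, htu, add_zero]
  · exact Cardinal.add_lt_of_lt hξ hst htu

/-- Lemma 4.15: for an infinite set `X` and a cardinal `ξ` with `ξ = 1` or
`ℵ₀ ≤ ξ ≤ (#X)⁺`, the relation `μ_ξ = {(α,β) : #(α △ β) < ξ}` is a congruence on
the partition monoid `P_X`. -/
theorem mu_isCongruence [Infinite X] (ξ : Cardinal)
    (hξ : ξ = 1 ∨ (ℵ₀ ≤ ξ ∧ ξ ≤ Order.succ #X)) :
    ∃ c : Con (PMon X), ∀ α β : PMon X,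
      c α β ↔ #↥(cl α ∆ cl β) < ξ := by
  have hξ' : ξ = 1 ∨ ℵ₀ ≤ ξ := hξ.imp_right And.left
  have hpos : 0 < ξ := by
    rcases hξ' with rfl | h
    · exact zero_lt_one
    · exact Cardinal.aleph0_pos.trans_le h
  refine ⟨{ r := fun α β => #↥(cl α ∆ cl β) < ξ
            iseqv := ⟨fun α => ?_, fun {α β} h => ?_, fun h k => mk_symmDiff_lt_trans hξ' h k⟩
            mul' := fun {α β γ δ} h k => ?_ }, fun α β => Iff.rfl⟩
  · rw [symmDiff_self]
    simpa using hpos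
  · rwa [symmDiff_comm]
  · exact mk_symmDiff_lt_trans hξ' ((mk_cl_mul_right_symmDiff_le α β γ).trans_lt h)
      ((mk_cl_mul_left_symmDiff_le γ δ β).trans_lt k)

end PartitionCongruences
end

section
/- Let X be an infinite set and let σ be a congruence on the partition monoid P_X. Then σ is the universal congruence (relating all pairs) if and only if there exist α, β ∈ P_X with (α,β) ∈ σ, rank(α) = #X and rank(β) < #X. (Lemma 5.14, with the parameter η(σ) = (#X)⁺ unwound.) -/
open Cardinal
open scoped symmDiff

namespace PartitionCongruences

variable {X : Type*}

theorem mul_rel_of_left {α β : PMon X} {a b : X ⊕ X} (h : α a b) :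
    (push (dmap X) α ⊔ push (umap X) β) (dmap X a) (dmap X b) :=
  (le_sup_left : push (dmap X) α ≤ _) (Relation.EqvGen.rel _ _ ⟨a, b, h, rfl, rfl⟩)

theorem mul_rel_of_right {α β : PMon X} {a b : X ⊕ X} (h : β a b) :
    (push (dmap X) α ⊔ push (umap X) β) (umap X a) (umap X b) :=
  (le_sup_right : push (umap X) β ≤ _) (Relation.EqvGen.rel _ _ ⟨a, b, h, rfl, rfl⟩)

theorem push_le {A B : Type*} {f : A → B} {σ : Setoid A} {R : Setoid B}
    (h : ∀ a b, σ a b → R (f a) (f b)) : push f σ ≤ R :=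
  Setoid.eqvGen_le (by rintro _ _ ⟨a, b, hab, rfl, rfl⟩; exact h a b hab)

/-- To bound a product it suffices to bound both factors inside the product graph. -/
theorem rel_of_mul {α β : PMon X} (R : Setoid (X ⊕ (X ⊕ X)))
    (hα : ∀ a b, α a b → R (dmap X a) (dmap X b))
    (hβ : ∀ a b, β a b → R (umap X a) (umap X b)) {a b : X ⊕ X} (h : (α * β) a b) :
    R (emap X a) (emap X b) :=
  (sup_le (push_le hα) (push_le hβ) :
    push (dmap X) α ⊔ push (umap X) β ≤ R) h

/-- The partition joining each upper point `x` to the lower point `f x`. -/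
abbrev upperMap (f : X → X) : PMon X := Setoid.ker (Sum.elim f id)

/-- The partition joining each lower point `x` to the upper point `f x`. -/
abbrev lowerMap (f : X → X) : PMon X := Setoid.ker (Sum.elim id f)

theorem upperMap_mul (f : X → X) (δ : PMon X) :
    upperMap f * δ = Setoid.comap (Sum.map f id) δ := by
  ext a b
  constructor
  · intro h
    have := rel_of_mul
      (Setoid.comap (Sum.elim (Sum.inl ∘ f) (Sum.elim Sum.inl Sum.inr) : _ → X ⊕ X) δ)
      (fun a b h => by
        have h : Sum.elim f id a = Sum.elim f id b := h
        rcases a with a | a <;> rcases b with b | b <;>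
          simp_all [Setoid.comap_rel, dmap, Setoid.refl])
      (fun a b h => by
        rcases a with a | a <;> rcases b with b | b <;> simpa [Setoid.comap_rel, umap] using h) h
    rcases a with a | a <;> rcases b with b | b <;>
      simpa [Setoid.comap_rel, emap] using this
  · intro h
    have key : ∀ a, (push (dmap X) (upperMap f) ⊔ push (umap X) δ) (emap X a)
        (umap X (Sum.map f id a)) := by
      rintro (i | i)
      · exact mul_rel_of_left (a := Sum.inl i) (b := Sum.inr (f i)) rfl
      · exact Setoid.refl' _ _
    exact Setoid.trans' (push (dmap X) (upperMap f) ⊔ push (umap X) δ) (key a)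
      (Setoid.trans' _ (mul_rel_of_right h) (Setoid.symm' _ (key b)))

theorem mul_lowerMap (f : X → X) (δ : PMon X) :
    δ * lowerMap f = Setoid.comap (Sum.map id f) δ := by
  ext a b
  constructor
  · intro h
    have := rel_of_mul
      (Setoid.comap (Sum.elim Sum.inl (Sum.elim Sum.inr (Sum.inr ∘ f)) : _ → X ⊕ X) δ)
      (fun a b h => by
        rcases a with a | a <;> rcases b with b | b <;> simpa [Setoid.comap_rel, dmap] using h)
      (fun a b h => by
        have h : Sum.elim id f a = Sum.elim id f b := h
        rcases a with a | a <;> rcases b with b | b <;>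
          simp_all [Setoid.comap_rel, umap, Setoid.refl]) h
    rcases a with a | a <;> rcases b with b | b <;>
      simpa [Setoid.comap_rel, emap] using this
  · intro h
    have key : ∀ a, (push (dmap X) δ ⊔ push (umap X) (lowerMap f)) (emap X a)
        (dmap X (Sum.map id f a)) := by
      rintro (i | i)
      · exact Setoid.refl' _ _
      · exact mul_rel_of_right (a := Sum.inr i) (b := Sum.inl (f i)) rfl
    exact Setoid.trans' (push (dmap X) δ ⊔ push (umap X) (lowerMap f)) (key a)
      (Setoid.trans' _ (mul_rel_of_left h) (Setoid.symm' _ (key b)))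

theorem upperMap_id_mul (δ : PMon X) : upperMap id * δ = δ := by
  rw [upperMap_mul, Sum.map_id_id]; rfl

theorem mul_upperMap_id (δ : PMon X) : δ * upperMap id = δ := by
  change δ * lowerMap id = δ
  rw [mul_lowerMap, Sum.map_id_id]; rfl

/-- `NoCross ζ` says that `ζ` has no transversals. -/
def NoCross (ζ : PMon X) : Prop := ∀ x y, ¬ ζ (Sum.inl x) (Sum.inr y)

theorem NoCross.mul_inl {ζ : PMon X} (hζ : NoCross ζ) {δ : PMon X} {x : X} {b : X ⊕ X}
    (h : (ζ * δ) (Sum.inl x) b) : ζ (Sum.inl x) b ∧ ∃ y, b = Sum.inl y := by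
  have := rel_of_mul (Setoid.ker (Sum.elim (fun t => some (Quotient.mk ζ (Sum.inl t)))
      (fun _ => none)))
    (fun a b h => by
      rcases a with a | a <;> rcases b with b | b
      · exact congrArg some (Quotient.sound h)
      · exact (hζ _ _ h).elim
      · exact (hζ _ _ (ζ.symm h)).elim
      · rfl)
    (fun a b h => by rcases a with a | a <;> rcases b with b | b <;> rfl) h
  rcases b with b | b
  · exact ⟨Quotient.exact (Option.some.inj this), b, rfl⟩
  · exact (Option.some_ne_none _ this).elim

theorem NoCross.mul_inr {ζ : PMon X} (hζ : NoCross ζ) {δ : PMon X} {x : X} {b : X ⊕ X}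
    (h : (δ * ζ) (Sum.inr x) b) : ζ (Sum.inr x) b ∧ ∃ y, b = Sum.inr y := by
  have := rel_of_mul (Setoid.ker (Sum.elim (fun _ => none) (Sum.elim (fun _ => none)
      (fun t => some (Quotient.mk ζ (Sum.inr t))))))
    (fun a b h => by rcases a with a | a <;> rcases b with b | b <;> rfl)
    (fun a b h => by
      rcases a with a | a <;> rcases b with b | b
      · rfl
      · exact (hζ _ _ h).elim
      · exact (hζ _ _ (ζ.symm h)).elim
      · exact congrArg some (Quotient.sound h)) h
  rcases b with b | b
  · exact (Option.some_ne_none _ this).elim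
  · exact ⟨Quotient.exact (Option.some.inj this), b, rfl⟩

theorem NoCross.mul_right {ζ : PMon X} (hζ : NoCross ζ) (δ : PMon X) : NoCross (ζ * δ) :=
  fun x y h => hζ x y (hζ.mul_inl h).1

theorem NoCross.mul_mul_self {ζ : PMon X} (hζ : NoCross ζ) (δ : PMon X) :
    ζ * δ * ζ = ζ := by
  ext a b
  constructor
  · intro h
    rcases a with a | a
    · exact (hζ.mul_inl ((hζ.mul_right δ).mul_inl h).1).1
    · exact (hζ.mul_inr h).1
  · intro h
    rcases a with a | a <;> rcases b with b | b
    · exact mul_rel_of_left (a := Sum.inl a) (b := Sum.inl b)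
        (mul_rel_of_left (a := Sum.inl a) (b := Sum.inl b) h)
    · exact (hζ _ _ h).elim
    · exact (hζ _ _ (ζ.symm h)).elim
    · exact mul_rel_of_right (a := Sum.inr a) (b := Sum.inr b) h

open Classical in
/-- The labelling of the points of `X ⊕ X` whose fibres are the blocks of `trace β S`. -/
noncomputable def traceLabel (β : PMon X) (S : Set X) : X ⊕ X → Quotient β ⊕ X :=
  Sum.elim (fun x => Sum.inl (Quotient.mk β (Sum.inl x)))
    (fun y => if y ∈ S then Sum.inl (Quotient.mk β (Sum.inl y)) else Sum.inr y)

/-- The partition with the same kernel as `β` in which the upper part of each block of `β` is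
joined to the lower copy of its points lying in `S`. -/
noncomputable abbrev trace (β : PMon X) (S : Set X) : PMon X := Setoid.ker (traceLabel β S)

theorem trace_inl_inl {β : PMon X} {S : Set X} {x y : X} :
    trace β S (Sum.inl x) (Sum.inl y) ↔ β (Sum.inl x) (Sum.inl y) := by
  simp only [Setoid.ker_def, traceLabel, Sum.elim_inl, Sum.inl.injEq]
  exact Quotient.eq

theorem trace_inl_inr {β : PMon X} {S : Set X} {x y : X} :
    trace β S (Sum.inl x) (Sum.inr y) ↔ y ∈ S ∧ β (Sum.inl x) (Sum.inl y) := by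
  by_cases hy : y ∈ S
  · simp only [Setoid.ker_def, traceLabel, Sum.elim_inl, Sum.elim_inr, hy, if_true,
      Sum.inl.injEq, true_and]
    exact Quotient.eq
  · simp [Setoid.ker_def, traceLabel, hy]

theorem trace_inr_inr {β : PMon X} {S : Set X} {x y : X}
    (h : trace β S (Sum.inr x) (Sum.inr y)) :
    x = y ∨ x ∈ S ∧ y ∈ S ∧ β (Sum.inl x) (Sum.inl y) := by
  by_cases hx : x ∈ S <;> by_cases hy : y ∈ S <;>
    simp only [Setoid.ker_def, traceLabel, Sum.elim_inr, hx, hy, if_true, if_false,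
      Sum.inl.injEq, Sum.inr.injEq, reduceCtorEq] at h
  · exact Or.inr ⟨hx, hy, Quotient.exact h⟩
  · exact Or.inl h

theorem trace_mul_self {β : PMon X} {S : Set X}
    (hS : ∀ x y, β (Sum.inl x) (Sum.inr y) → ∃ s ∈ S, β (Sum.inl x) (Sum.inl s)) :
    trace β S * β = β := by
  ext a b
  constructor
  · intro h
    have := rel_of_mul (Setoid.comap (Sum.elim Sum.inl id : _ → X ⊕ X) β)
      (fun a b h => by
        rcases a with a | a <;> rcases b with b | b
        · exact trace_inl_inl.1 h
        · exact (trace_inl_inr.1 h).2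
        · exact β.symm (trace_inl_inr.1 ((trace β S).symm h)).2
        · rcases trace_inr_inr h with rfl | h
          · exact β.refl _
          · exact h.2.2)
      (fun a b h => by rcases a with a | a <;> rcases b with b | b <;> exact h) h
    rcases a with a | a <;> rcases b with b | b <;> exact this
  · have cross : ∀ x y, β (Sum.inl x) (Sum.inr y) →
        (trace β S * β) (Sum.inl x) (Sum.inr y) := by
      intro x y h
      obtain ⟨s, hs, hxs⟩ := hS x y h
      exact Setoid.trans'
        (push (dmap X) (trace β S) ⊔ push (umap X) β)
        (mul_rel_of_left (a := Sum.inl x) (b := Sum.inr s) (trace_inl_inr.2 ⟨hs, hxs⟩))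
        (mul_rel_of_right (a := Sum.inl s) (b := Sum.inr y) (β.trans (β.symm hxs) h))
    intro h
    rcases a with a | a <;> rcases b with b | b
    · exact mul_rel_of_left (a := Sum.inl a) (b := Sum.inl b) (trace_inl_inl.2 h)
    · exact cross a b h
    · exact Setoid.symm' _ (cross b a (β.symm h))
    · exact mul_rel_of_right (a := Sum.inr a) (b := Sum.inr b) h

theorem exists_mem_of_trace_mul {α β : PMon X} {S : Set X} {x y : X}
    (h : (trace β S * α) (Sum.inl x) (Sum.inr y)) :
    ∃ s ∈ S, α (Sum.inl s) (Sum.inr y) := by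
  have := rel_of_mul (Setoid.ker (Sum.elim (fun _ => True)
      (fun t => ∃ s ∈ S, α (Sum.inl s) t)))
    (fun a b h => by
      rcases a with a | a <;> rcases b with b | b
      · rfl
      · exact (eq_true ⟨b, (trace_inl_inr.1 h).1, α.refl _⟩).symm
      · exact eq_true ⟨a, (trace_inl_inr.1 ((trace β S).symm h)).1, α.refl _⟩
      · rcases trace_inr_inr h with rfl | ⟨ha, hb, -⟩
        · rfl
        · exact (eq_true ⟨a, ha, α.refl _⟩).trans (eq_true ⟨b, hb, α.refl _⟩).symm)
    (fun a b h => by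
      have : (∃ s ∈ S, α (Sum.inl s) a) = ∃ s ∈ S, α (Sum.inl s) b :=
        propext ⟨fun ⟨s, hs, hsa⟩ => ⟨s, hs, α.trans hsa h⟩,
          fun ⟨s, hs, hsb⟩ => ⟨s, hs, α.trans hsb (α.symm h)⟩⟩
      rcases a with a | a <;> rcases b with b | b <;> exact this) h
  exact of_eq_true (Eq.symm this)

/-- A set of upper points, no larger than the rank, that meets every transversal. -/
theorem exists_meets_transversals (β : PMon X) : ∃ S : Set X, #S ≤ rank β ∧
    ∀ x y, β (Sum.inl x) (Sum.inr y) → ∃ s ∈ S, β (Sum.inl x) (Sum.inl s) := by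
  choose p hp using fun B : {B : Set (X ⊕ X) // IsTransversal β B} => B.2.2.1
  refine ⟨Set.range p, mk_range_le, fun x y h => ?_⟩
  have hB : IsTransversal β {b | β b (Sum.inl x)} :=
    ⟨⟨_, rfl⟩, ⟨x, β.refl _⟩, ⟨y, β.symm h⟩⟩
  exact ⟨_, ⟨⟨_, hB⟩, rfl⟩, β.symm (hp ⟨_, hB⟩)⟩

/-- A partition of full rank has `#X` transversals avoiding a given small set of upper points. -/
theorem exists_transversals_avoiding [Infinite X] {α : PMon X} (hα : rank α = #X)
    {S : Set X} (hS : #S < #X) : ∃ x y : X → X,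
      (∀ i, α (Sum.inl (x i)) (Sum.inr (y i))) ∧
      (∀ i j, α (Sum.inl (x i)) (Sum.inl (x j)) → i = j) ∧
      ∀ i, ∀ s ∈ S, ¬ α (Sum.inl s) (Sum.inr (y i)) := by
  let T : Set (Set (X ⊕ X)) := {B | IsTransversal α B ∧ ∀ s ∈ S, Sum.inl s ∉ B}
  have hT : #X ≤ #T := by
    by_contra! hlt
    have hsub : {B | IsTransversal α B} ⊆
        T ∪ Set.range (fun s : S => {b | α b (Sum.inl s.1)}) := by
      intro B hB
      by_cases h : ∀ s ∈ S, Sum.inl s ∉ B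
      · exact Or.inl ⟨hB, h⟩
      · push Not at h
        obtain ⟨s, hs, hsB⟩ := h
        obtain ⟨z, rfl⟩ := hB.1
        refine Or.inr ⟨⟨s, hs⟩, Set.ext fun b => ?_⟩
        exact ⟨fun h => α.trans h hsB, fun h => α.trans h (α.symm hsB)⟩
    have hle := (mk_le_mk_of_subset hsub).trans (mk_union_le _ _)
    have hlt' := add_lt_of_lt (aleph0_le_mk X) hlt
      ((mk_range_le (f := fun s : S => {b | α b (Sum.inl s.1)})).trans_lt hS)
    exact (hle.trans_lt hlt').ne hα
  obtain ⟨e⟩ := (le_def _ _).1 hT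
  choose x hx using fun i => (e i).2.1.2.1
  choose y hy using fun i => (e i).2.1.2.2
  have rel : ∀ (i : X) {a b}, a ∈ (e i).1 → b ∈ (e i).1 → α a b := fun i _ _ ha hb =>
    Setoid.rel_iff_exists_classes α |>.2 ⟨_, (e i).2.1.1, ha, hb⟩
  have mem : ∀ (i : X) {a b}, a ∈ (e i).1 → α a b → b ∈ (e i).1 := by
    intro i a b ha hab
    obtain ⟨z, hz⟩ := (e i).2.1.1
    rw [hz] at ha ⊢
    exact α.trans (α.symm hab) ha
  refine ⟨x, y, fun i => rel i (hx i) (hy i), fun i j h => ?_, fun i s hs h => ?_⟩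
  · exact e.injective (Subtype.ext (Setoid.eq_of_mem_classes (e i).2.1.1
      (mem i (hx i) h) (e j).2.1.1 (hx j)))
  · exact (e i).2.2 s hs (mem i (hy i) (α.symm h))

theorem rank_upperMap_id : rank (upperMap (id : X → X)) = #X := by
  have htr : ∀ i : X, IsTransversal (upperMap id) {b | upperMap id b (Sum.inl i)} :=
    fun i => ⟨⟨_, rfl⟩, ⟨i, rfl⟩, ⟨i, rfl⟩⟩
  refine (mk_congr (Equiv.ofBijective (fun i => ⟨_, htr i⟩) ⟨fun i j h => ?_, ?_⟩)).symm
  · have h : (Sum.inl i : X ⊕ X) ∈ {b | upperMap id b (Sum.inl j)} :=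
      (Set.ext_iff.1 (congrArg Subtype.val h) _).1 rfl
    exact h
  · rintro ⟨_, ⟨z, rfl⟩, ⟨x, hx⟩, -⟩
    refine ⟨x, Subtype.ext (Set.ext fun b => ?_)⟩
    exact ⟨fun h => Eq.trans h hx, fun h => Eq.trans h (Eq.symm hx)⟩

theorem rank_bot : rank (⊥ : PMon X) = 0 := by
  refine mk_eq_zero_iff.2 ⟨?_⟩
  rintro ⟨_, ⟨z, rfl⟩, ⟨x, hx⟩, ⟨y, hy⟩⟩
  exact Sum.inl_ne_inr ((hx : Sum.inl x = z).trans (hy : Sum.inr y = z).symm)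

/-- A congruence relating the identity to a partition without transversals is universal. -/
theorem universal_of_rel_noCross {c : Con (PMon X)} {ζ : PMon X} (hζ : NoCross ζ)
    (h : c (upperMap id) ζ) (α β : PMon X) : c α β := by
  have key : ∀ δ, c δ ζ := fun δ => by
    simpa only [upperMap_id_mul, mul_upperMap_id, hζ.mul_mul_self] using
      c.mul (c.mul h (c.refl δ)) h
  exact c.trans (key α) (c.symm (key β))

/-- Lemma 5.14 (with `η(σ) = (#X)⁺` unwound): a congruence on `P_X` is universal
iff it relates some pair `(α,β)` with `rank α = #X` and `rank β < #X`. -/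
theorem universal_iff_collapses_top [Infinite X] (c : Con (PMon X)) :
    (∀ α β : PMon X, c α β) ↔
      ∃ α β : PMon X, c α β ∧ rank α = #X ∧ rank β < #X := by
  constructor
  · exact fun h => ⟨upperMap id, ⊥, h _ _, rank_upperMap_id,
      rank_bot.trans_lt (pos_iff_ne_zero.2 (mk_ne_zero X))⟩
  · rintro ⟨α, β, hc, hα, hβ⟩
    obtain ⟨S, hSβ, hS⟩ := exists_meets_transversals β
    obtain ⟨x, y, hxy, hinj, hav⟩ := exists_transversals_avoiding hα (hSβ.trans_lt hβ)
    have hαθ : c α (trace β S * α) := by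
      have := c.mul (c.refl (trace β S)) hc
      rw [trace_mul_self hS] at this
      exact c.trans hc (c.symm this)
    have h := c.mul (c.refl (upperMap x)) (c.mul hαθ (c.refl (lowerMap y)))
    have hone : upperMap x * (α * lowerMap y) = upperMap id := by
      rw [upperMap_mul, mul_lowerMap]
      have hrel : ∀ a, α (Sum.map x y a) (Sum.inl (x (Sum.elim id id a))) := by
        rintro (i | i)
        · exact α.refl _
        · exact α.symm (hxy i)
      ext a b
      have : Setoid.comap (Sum.map x id) (Setoid.comap (Sum.map id y) α) a b ↔
          α (Sum.map x y a) (Sum.map x y b) := by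
        simp [Setoid.comap_rel]
      rw [this]
      refine ⟨fun h => hinj _ _ (α.trans (α.symm (hrel a)) (α.trans h (hrel b))), fun h => ?_⟩
      have h : Sum.elim id id a = Sum.elim id id b := h
      exact α.trans (hrel a) (h ▸ α.symm (hrel b))
    rw [hone] at h
    refine universal_of_rel_noCross (fun i j hij => ?_) h
    rw [upperMap_mul, mul_lowerMap] at hij
    obtain ⟨s, hs, hsj⟩ := exists_mem_of_trace_mul
      (show (trace β S * α) (Sum.inl (x i)) (Sum.inr (y j)) from hij)
    exact hav j s hs hsj

end PartitionCongruences
end
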